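/- arXiv:math-ph/0611018 — 7 statements merged into one kernel-verified Lean document; each statement's English description precedes it below -/
import Mathlib

section
/- Let φ₁, φ₂ ∈ ℂ with |φ₁|² + |φ₂|² ≠ 0, let N = [[φ₁, −conj(φ₂)], [φ₂, conj(φ₁)]] (which is invertible), and set M = N H N⁻¹. Then the following six conditions hold simultaneously — [H,M] ∈ ℂ·E, [F,M] ∈ ℂ·E, M E M ∈ ℂ·E, M H M ∈ span_ℂ{H,F}, M F M ∈ span_ℂ{H,F}, [E,M] ∈ span_ℂ{H,F} — if and only if Im(φ₁)·Im(φ₂) + Re(φ₁)·Re(φ₂) = 0. -/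
open Matrix Complex

noncomputable section

/-- The su(2) basis element H = [[i,0],[0,-i]]. -/
def Hm : Matrix (Fin 2) (Fin 2) ℂ := !![I, 0; 0, -I]
/-- The su(2) basis element F = [[0,1],[-1,0]]. -/
def Fm : Matrix (Fin 2) (Fin 2) ℂ := !![0, 1; -1, 0]
/-- The su(2) basis element E = [[0,i],[i,0]]. -/
def Em : Matrix (Fin 2) (Fin 2) ℂ := !![0, I; I, 0]

lemma M_form (a b : ℂ) (h : Complex.normSq a + Complex.normSq b ≠ 0) :
    ∃ p q : ℂ, !![a, -(starRingEnd ℂ) b; b, (starRingEnd ℂ) a] * Hm *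
      (!![a, -(starRingEnd ℂ) b; b, (starRingEnd ℂ) a])⁻¹ =
      p • Hm + q • Fm + ((2 * (a.im * b.im + a.re * b.re) /
        (Complex.normSq a + Complex.normSq b) : ℝ) : ℂ) • Em := by
  have hD : a * (starRingEnd ℂ) a + b * (starRingEnd ℂ) b ≠ 0 := by
    rw [Complex.mul_conj, Complex.mul_conj]; exact_mod_cast h
  have hr : ((2 * (a.im * b.im + a.re * b.re) /
        (Complex.normSq a + Complex.normSq b) : ℝ) : ℂ) =
      (a * (starRingEnd ℂ) b + b * (starRingEnd ℂ) a) /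
        (a * (starRingEnd ℂ) a + b * (starRingEnd ℂ) b) := by
    rw [Complex.mul_conj, Complex.mul_conj]
    push_cast
    congr 1
    apply Complex.ext <;> simp <;> ring
  rw [hr]
  have hI : I * I = -1 := Complex.I_mul_I
  generalize (starRingEnd ℂ) a = ac at *
  generalize (starRingEnd ℂ) b = bc at *
  have hD1 : ac * a + bc * b ≠ 0 := by rwa [mul_comm ac, mul_comm bc]
  have hD2 : bc * b + ac * a ≠ 0 := by rwa [add_comm]
  have hD3 : bc * b + a * ac ≠ 0 := by rwa [mul_comm a ac]
  have hD4 : b * bc + a * ac ≠ 0 := by rwa [mul_comm b bc]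
  have hD5 : a * ac + bc * b ≠ 0 := by rwa [add_comm]
  refine ⟨(a * ac - b * bc) / (a * ac + b * bc),
    I * (a * bc - b * ac) / (a * ac + b * bc), ?_⟩
  have hdet : (!![a, -bc; b, ac]).det = a * ac + b * bc := by
    rw [Matrix.det_fin_two_of]; ring
  have hu : IsUnit (!![a, -bc; b, ac]).det := by
    rw [hdet]; exact isUnit_iff_ne_zero.mpr hD
  rw [← Matrix.mul_nonsing_inv_cancel_right _ (((a * ac - b * bc) / (a * ac + b * bc)) • Hm +
    (I * (a * bc - b * ac) / (a * ac + b * bc)) • Fm +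
      ((a * bc + b * ac) / (a * ac + b * bc)) • Em) hu]
  congr 1
  ext i j
  fin_cases i <;> fin_cases j <;>
    simp [Hm, Fm, Em, Matrix.mul_apply, Fin.sum_univ_two] <;> field_simp <;>
    ring

/-- the six span conditions on M = N H N⁻¹ hold simultaneously iff
Im(φ₁)·Im(φ₂) + Re(φ₁)·Re(φ₂) = 0. -/
theorem stmt0 (φ₁ φ₂ : ℂ) (hφ : Complex.normSq φ₁ + Complex.normSq φ₂ ≠ 0)
    (N : Matrix (Fin 2) (Fin 2) ℂ)
    (hN : N = !![φ₁, -(starRingEnd ℂ) φ₂; φ₂, (starRingEnd ℂ) φ₁])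
    (M : Matrix (Fin 2) (Fin 2) ℂ) (hM : M = N * Hm * N⁻¹) :
    ((∃ c : ℂ, Hm * M - M * Hm = c • Em) ∧
     (∃ c : ℂ, Fm * M - M * Fm = c • Em) ∧
     (∃ c : ℂ, M * Em * M = c • Em) ∧
     (∃ a b : ℂ, M * Hm * M = a • Hm + b • Fm) ∧
     (∃ a b : ℂ, M * Fm * M = a • Hm + b • Fm) ∧
     (∃ a b : ℂ, Em * M - M * Em = a • Hm + b • Fm)) ↔
    φ₁.im * φ₂.im + φ₁.re * φ₂.re = 0 := by
  subst hN
  obtain ⟨p, q, hpq⟩ := M_form φ₁ φ₂ hφ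
  rw [hpq] at hM
  have hI : I * I = -1 := Complex.I_mul_I
  constructor
  · rintro ⟨⟨c, hc⟩, -⟩
    rw [hM] at hc
    have h1 := congrFun (congrFun hc 0) 1
    have h2 := congrFun (congrFun hc 1) 0
    generalize hr : ((2 * (φ₁.im * φ₂.im + φ₁.re * φ₂.re) /
        (Complex.normSq φ₁ + Complex.normSq φ₂) : ℝ) : ℂ) = r at *
    simp only [Hm, Fm, Em, Matrix.mul_apply, Fin.sum_univ_two, Matrix.sub_apply,
      Matrix.add_apply, Matrix.smul_apply, Matrix.of_apply, Matrix.cons_val', Matrix.cons_val_zero,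
      Matrix.cons_val_one, Matrix.cons_val_fin_one, smul_eq_mul] at h1 h2
    have h3 : r = 0 := by linear_combination (-1/4) * (h1 - h2) + r * hI
    rw [h3, Complex.ofReal_eq_zero, div_eq_zero_iff] at hr
    rcases hr with hr | hr
    · linarith
    · exact absurd hr hφ
  · intro h
    rw [h] at hM
    simp only [mul_zero, zero_div, Complex.ofReal_zero, zero_smul, add_zero] at hM
    subst hM
    refine ⟨⟨2 * q, ?_⟩, ⟨-2 * p, ?_⟩, ⟨p ^ 2 + q ^ 2, ?_⟩, ⟨q ^ 2 - p ^ 2, -2 * p * q, ?_⟩,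
      ⟨-2 * p * q, p ^ 2 - q ^ 2, ?_⟩, ⟨-2 * q, 2 * p, ?_⟩⟩ <;>
    · ext i j
      fin_cases i <;> fin_cases j <;>
        simp [Hm, Fm, Em, Matrix.mul_apply, Fin.sum_univ_two] <;> ring_nf <;>
        simp [mul_assoc]
end
end

section
/- Let m > 0, σ > 0, ω₀ ∈ ℝ, and let λ ∈ ℂ with Im λ > 0 be such that the three points λ, im, ω₀ + iσ are pairwise distinct. Then ∫_{−∞}^{∞} ω / ((ω² − λ²)(ω² + m²)((ω − ω₀)² + σ²)) dω = πi/((λ² + m²)((λ − ω₀)² + σ²)) − πi/((λ² + m²)((im − ω₀)² + σ²)) + π(ω₀ + iσ)/(σ·((ω₀ + iσ)² − λ²)·((ω₀ + iσ)² + m²)). -/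
open Complex Real MeasureTheory

noncomputable section

lemma aux_ne (u : ℂ) (hu : u.im ≠ 0) (w : ℝ) : (w : ℂ) - u ≠ 0 := by
  intro h
  apply hu
  have := congrArg Complex.im h
  simpa using this

lemma aux_intsq (u : ℂ) (hu : u.im ≠ 0) :
    Integrable (fun w : ℝ => (‖(w : ℂ) - u‖ ^ 2)⁻¹) := by
  have h := (integrable_inv_one_add_sq.comp_div hu).comp_sub_right u.re
  have h2 := h.const_mul ((u.im ^ 2)⁻¹)
  refine h2.congr (Filter.Eventually.of_forall fun w => ?_)
  have : ‖(w : ℂ) - u‖ ^ 2 = (w - u.re) ^ 2 + u.im ^ 2 := by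
    rw [← Complex.normSq_eq_norm_sq, Complex.normSq_apply]
    simp
    ring
  simp only [this]
  rw [← mul_inv]
  congr 1
  field_simp
  ring

lemma aux_int (u v : ℂ) (hu : u.im ≠ 0) (hv : v.im ≠ 0) :
    Integrable (fun w : ℝ => 1 / (((w : ℂ) - u) * ((w : ℂ) - v))) := by
  refine ((aux_intsq u hu).add (aux_intsq v hv)).mono' ?_ (Filter.Eventually.of_forall fun w => ?_)
  · apply Continuous.aestronglyMeasurable
    refine continuous_const.div (by fun_prop) fun w => mul_ne_zero (aux_ne u hu w) (aux_ne v hv w)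
  · simp only [Pi.add_apply, norm_mul, norm_inv, one_div, mul_inv]
    rw [← inv_pow, ← inv_pow]
    nlinarith [sq_nonneg (‖(w : ℂ) - u‖⁻¹ - ‖(w : ℂ) - v‖⁻¹), sq_nonneg (‖(w : ℂ) - u‖⁻¹),
      sq_nonneg (‖(w : ℂ) - v‖⁻¹)]

lemma aux_inv (u : ℂ) (l : Filter ℝ) (h : Filter.Tendsto (fun w : ℝ => w⁻¹) l (nhds 0)) :
    Filter.Tendsto (fun w : ℝ => Complex.log (1 - u * ((w⁻¹ : ℝ) : ℂ))) l (nhds 0) := by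
  have h1 : Filter.Tendsto (fun w : ℝ => 1 - u * ((w⁻¹ : ℝ) : ℂ)) l (nhds 1) := by
    have h2 := (Complex.continuous_ofReal.tendsto 0).comp h
    simpa using (h2.const_mul u).const_sub 1
  have := h1.clog (by simp)
  simpa using this

lemma aux_top (u : ℂ) (hu : u.im ≠ 0) :
    Filter.Tendsto (fun w : ℝ => Complex.log ((w : ℂ) - u) - (Real.log w : ℂ))
      Filter.atTop (nhds 0) := by
  refine (aux_inv u _ tendsto_inv_atTop_zero).congr' ?_
  filter_upwards [Filter.eventually_gt_atTop 0] with w hw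
  have hw' : (w : ℂ) ≠ 0 := by exact_mod_cast hw.ne'
  have e : (w : ℂ) - u = (w : ℂ) * (1 - u * ((w⁻¹ : ℝ) : ℂ)) := by
    push_cast; field_simp
  have hne : 1 - u * ((w⁻¹ : ℝ) : ℂ) ≠ 0 := by
    intro h; apply aux_ne u hu w; rw [e, h, mul_zero]
  rw [e, Complex.log_ofReal_mul hw hne]
  ring

lemma aux_bot0 (u : ℂ) (hu : u.im ≠ 0) :
    Filter.Tendsto (fun w : ℝ => Complex.log (-((w : ℂ) - u)) - (Real.log w : ℂ))
      Filter.atBot (nhds 0) := by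
  refine (aux_inv u _ tendsto_inv_atBot_zero).congr' ?_
  filter_upwards [Filter.eventually_lt_atBot 0] with w hw
  have hw' : (w : ℂ) ≠ 0 := by exact_mod_cast hw.ne
  have e : -((w : ℂ) - u) = ((-w : ℝ) : ℂ) * (1 - u * ((w⁻¹ : ℝ) : ℂ)) := by
    push_cast; field_simp
  have hne : 1 - u * ((w⁻¹ : ℝ) : ℂ) ≠ 0 := by
    intro h; apply aux_ne u hu w; rw [← neg_eq_zero, e, h, mul_zero]
  rw [e, Complex.log_ofReal_mul (by linarith) hne, Real.log_neg_eq_log]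
  ring

lemma aux_bot_up (u : ℂ) (hu : 0 < u.im) :
    Filter.Tendsto (fun w : ℝ => Complex.log ((w : ℂ) - u) - (Real.log w : ℂ))
      Filter.atBot (nhds (-(π * I))) := by
  have h := (aux_bot0 u hu.ne').sub_const (π * I)
  rw [zero_sub] at h
  refine h.congr fun w => ?_
  have : Complex.arg (-((w : ℂ) - u)) = Complex.arg ((w : ℂ) - u) + π :=
    Complex.arg_neg_eq_arg_add_pi_of_im_neg (by simpa using hu)
  simp only [Complex.log, norm_neg, this]
  push_cast
  ring

lemma aux_bot_low (u : ℂ) (hu : u.im < 0) :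
    Filter.Tendsto (fun w : ℝ => Complex.log ((w : ℂ) - u) - (Real.log w : ℂ))
      Filter.atBot (nhds (π * I)) := by
  have h := (aux_bot0 u hu.ne).add_const (π * I)
  rw [zero_add] at h
  refine h.congr fun w => ?_
  have : Complex.arg (-((w : ℂ) - u)) = Complex.arg ((w : ℂ) - u) - π :=
    Complex.arg_neg_eq_arg_sub_pi_of_im_pos (by simpa using hu)
  simp only [Complex.log, norm_neg, this]
  push_cast
  ring

lemma aux_gen (u v a b : ℂ) (hu : u.im ≠ 0) (hv : v.im ≠ 0) (huv : u ≠ v)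
    (ha : Filter.Tendsto (fun w : ℝ => Complex.log ((w : ℂ) - u) - (Real.log w : ℂ))
      Filter.atBot (nhds a))
    (hb : Filter.Tendsto (fun w : ℝ => Complex.log ((w : ℂ) - v) - (Real.log w : ℂ))
      Filter.atBot (nhds b)) :
    ∫ w : ℝ, 1 / (((w : ℂ) - u) * ((w : ℂ) - v)) = (b - a) / (u - v) := by
  have hd : ∀ z : ℂ, z.im ≠ 0 → ∀ w : ℝ,
      HasDerivAt (fun w : ℝ => Complex.log ((w : ℂ) - z)) (1 / ((w : ℂ) - z)) w := by
    intro z hz w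
    have h1 : HasDerivAt (fun w : ℝ => (w : ℂ) - z) 1 w :=
      (Complex.ofRealCLM.hasDerivAt (x := w)).sub_const z
    exact h1.clog_real (Or.inr (by simpa using hz))
  have huv' : u - v ≠ 0 := sub_ne_zero.mpr huv
  have key := integral_of_hasDerivAt_of_tendsto
    (f := fun w : ℝ => (Complex.log ((w : ℂ) - u) - Complex.log ((w : ℂ) - v)) / (u - v))
    (f' := fun w : ℝ => 1 / (((w : ℂ) - u) * ((w : ℂ) - v)))
    (m := (a - b) / (u - v)) (n := 0) ?_ (aux_int u v hu hv) ?_ ?_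
  · rw [key]; ring
  · intro w
    have := ((hd u hu w).sub (hd v hv w)).div_const (u - v)
    refine this.congr_deriv ?_
    have := aux_ne u hu w
    have := aux_ne v hv w
    field_simp
    ring
  · refine ((ha.sub hb).div_const (u - v)).congr fun w => ?_
    congr 1; ring
  · have := (((aux_top u hu).sub (aux_top v hv)).div_const (u - v))
    simp only [sub_zero, zero_div] at this
    refine this.congr fun w => ?_
    congr 1; ring

lemma aux_ul (u v : ℂ) (hu : 0 < u.im) (hv : v.im < 0) :
    ∫ w : ℝ, 1 / (((w : ℂ) - u) * ((w : ℂ) - v)) = 2 * π * I / (u - v) := by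
  rw [aux_gen u v _ _ hu.ne' hv.ne (by rintro rfl; linarith) (aux_bot_up u hu) (aux_bot_low v hv)]
  ring

lemma aux_ll (u v : ℂ) (hu : u.im < 0) (hv : v.im < 0) :
    ∫ w : ℝ, 1 / (((w : ℂ) - u) * ((w : ℂ) - v)) = 0 := by
  by_cases huv : u = v
  · subst huv
    have hT : ∀ l : Filter ℝ, Filter.Tendsto (fun w : ℝ => ‖(w : ℂ)‖) l Filter.atTop →
        Filter.Tendsto (fun w : ℝ => -((w : ℂ) - u)⁻¹) l (nhds 0) := by
      intro l hl
      have h1 : Filter.Tendsto (fun w : ℝ => (w : ℂ) - u) l (Bornology.cobounded ℂ) := by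
        rw [← tendsto_norm_atTop_iff_cobounded]
        refine Filter.tendsto_atTop_mono (fun w => norm_sub_norm_le (w : ℂ) u) ?_
        exact Filter.tendsto_atTop_add_const_right _ _ hl
      simpa using (Filter.tendsto_inv₀_cobounded.comp h1).neg
    have key := integral_of_hasDerivAt_of_tendsto
      (f := fun w : ℝ => -((w : ℂ) - u)⁻¹)
      (f' := fun w : ℝ => 1 / (((w : ℂ) - u) * ((w : ℂ) - u)))
      (m := 0) (n := 0) ?_ (aux_int u u hu.ne hu.ne) (hT _ ?_) (hT _ ?_)
    · rw [key]; ring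
    · intro w
      have h1 : HasDerivAt (fun w : ℝ => (w : ℂ) - u) 1 w :=
        (Complex.ofRealCLM.hasDerivAt (x := w)).sub_const u
      refine (h1.inv (aux_ne u hu.ne w)).neg.congr_deriv ?_
      have := aux_ne u hu.ne w
      field_simp
    · simpa using Filter.tendsto_abs_atBot_atTop
    · simpa using Filter.tendsto_abs_atTop_atTop
  · rw [aux_gen u v _ _ hu.ne hv.ne huv (aux_bot_low u hu) (aux_bot_low v hv)]
    ring

/-- The integral with one quadratic factor removed. -/
lemma aux_K (u p q : ℂ) (hu : 0 < u.im) (hp : 0 < p.im) (hq : q.im < 0) (hup : u ≠ p) :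
    Integrable (fun w : ℝ => (w : ℂ) / (((w : ℂ) ^ 2 - u ^ 2) * (((w : ℂ) - p) * ((w : ℂ) - q)))) ∧
    ∫ w : ℝ, (w : ℂ) / (((w : ℂ) ^ 2 - u ^ 2) * (((w : ℂ) - p) * ((w : ℂ) - q)))
      = π * I / ((u - p) * (u - q)) + 2 * π * I * p / ((p - q) * (p ^ 2 - u ^ 2)) := by
  have hmu : (-u).im < 0 := by simpa using hu
  have n1 : u - p ≠ 0 := sub_ne_zero.mpr hup
  have n2 : p + u ≠ 0 := by
    intro h; have := congrArg Complex.im h; simp at this; linarith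
  have n3 : u - q ≠ 0 := by
    intro h; have := congrArg Complex.im h; simp at this; linarith
  have n4 : p - q ≠ 0 := by
    intro h; have := congrArg Complex.im h; simp at this; linarith
  have n5 : p ^ 2 - u ^ 2 ≠ 0 := by
    rw [sq_sub_sq]; exact mul_ne_zero n2 (by rw [← neg_sub]; exact neg_ne_zero.mpr n1)
  have i1 := (aux_int u q hu.ne' hq.ne).const_mul (1 / (2 * (u - p)))
  have i2 := (aux_int p q hp.ne' hq.ne).const_mul (1 / (2 * (p + u)) - 1 / (2 * (u - p)))
  have i3 := (aux_int (-u) q hmu.ne hq.ne).const_mul (1 / (2 * (p + u)))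
  have e : (fun w : ℝ => (w : ℂ) / (((w : ℂ) ^ 2 - u ^ 2) * (((w : ℂ) - p) * ((w : ℂ) - q)))) =
      fun w : ℝ => 1 / (2 * (u - p)) * (1 / (((w : ℂ) - u) * ((w : ℂ) - q))) +
        (1 / (2 * (p + u)) - 1 / (2 * (u - p))) * (1 / (((w : ℂ) - p) * ((w : ℂ) - q))) -
        1 / (2 * (p + u)) * (1 / (((w : ℂ) - -u) * ((w : ℂ) - q))) := by
    funext w
    have m1 := aux_ne u hu.ne' w
    have m2 := aux_ne (-u) hmu.ne w
    have m3 := aux_ne p hp.ne' w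
    have m4 := aux_ne q hq.ne w
    rw [sub_neg_eq_add] at m2 ⊢
    rw [sq_sub_sq]
    field_simp
    ring
  rw [e]
  refine ⟨(i1.add i2).sub i3, ?_⟩
  have i12 : Integrable (fun w : ℝ => 1 / (2 * (u - p)) * (1 / (((w : ℂ) - u) * ((w : ℂ) - q))) +
        (1 / (2 * (p + u)) - 1 / (2 * (u - p))) * (1 / (((w : ℂ) - p) * ((w : ℂ) - q)))) :=
    i1.add i2
  rw [integral_sub i12 i3, integral_add i1 i2]
  simp only [integral_const_mul]
  rw [aux_ul u q hu hq, aux_ul p q hp hq, aux_ll (-u) q hmu hq]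
  have n6 : p - u ≠ 0 := by rw [← neg_sub]; exact neg_ne_zero.mpr n1
  have e5 : p ^ 2 - u ^ 2 = - ((u - p) * (p + u)) := by ring
  rw [e5]
  field_simp
  ring

/-- residue evaluation of
∫ ω/((ω² − λ²)(ω² + m²)((ω − ω₀)² + σ²)) dω over ℝ. -/
theorem stmt6 (m σ ω₀ : ℝ) (hm : 0 < m) (hσ : 0 < σ) (lam : ℂ)
    (hlam : 0 < lam.im)
    (h1 : lam ≠ I * m) (h2 : lam ≠ (ω₀ : ℂ) + I * σ)
    (h3 : I * (m : ℂ) ≠ (ω₀ : ℂ) + I * σ) :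
    ∫ ω : ℝ, (ω : ℂ) /
        (((ω : ℂ) ^ 2 - lam ^ 2) * ((ω : ℂ) ^ 2 + (m : ℂ) ^ 2) *
          (((ω : ℂ) - ω₀) ^ 2 + (σ : ℂ) ^ 2))
      = (π : ℂ) * I / ((lam ^ 2 + (m : ℂ) ^ 2) * ((lam - ω₀) ^ 2 + (σ : ℂ) ^ 2))
        - (π : ℂ) * I /
            ((lam ^ 2 + (m : ℂ) ^ 2) * ((I * m - ω₀) ^ 2 + (σ : ℂ) ^ 2))
        + (π : ℂ) * ((ω₀ : ℂ) + I * σ) /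
            ((σ : ℂ) * (((ω₀ : ℂ) + I * σ) ^ 2 - lam ^ 2) *
              (((ω₀ : ℂ) + I * σ) ^ 2 + (m : ℂ) ^ 2)) := by
  have hI : (I : ℂ) ^ 2 = -1 := Complex.I_sq
  have him : 0 < (I * (m : ℂ)).im := by simpa using hm
  have hp : 0 < ((ω₀ : ℂ) + I * σ).im := by simpa using hσ
  have hq : ((ω₀ : ℂ) - I * σ).im < 0 := by simpa using hσ
  obtain ⟨iA, eA⟩ := aux_K lam _ _ hlam hp hq h2
  obtain ⟨iB, eB⟩ := aux_K (I * m) _ _ him hp hq h3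
  have hsum : ∀ a b : ℂ, 0 < a.im → 0 < b.im → a + b ≠ 0 := by
    intro a b ha hb h
    have := congrArg Complex.im h; simp at this; linarith
  have hne : ∀ a b : ℂ, 0 < a.im → 0 < b.im → a ≠ b → a ^ 2 - b ^ 2 ≠ 0 := by
    intro a b ha hb hab
    rw [sq_sub_sq]
    exact mul_ne_zero (hsum a b ha hb) (sub_ne_zero.mpr hab)
  have hmI : (I * (m : ℂ)) ^ 2 = -(m : ℂ) ^ 2 := by rw [mul_pow, hI]; ring
  have n1 : lam ^ 2 + (m : ℂ) ^ 2 ≠ 0 := by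
    have := hne _ _ hlam him h1
    rwa [hmI, sub_neg_eq_add] at this
  have n2 := hne _ _ hp hlam h2.symm
  have n3 : ((ω₀ : ℂ) + I * σ) ^ 2 + (m : ℂ) ^ 2 ≠ 0 := by
    have := hne _ _ hp him h3.symm
    rwa [hmI, sub_neg_eq_add] at this
  have hquad : ∀ z : ℂ, (z - ((ω₀ : ℂ) + I * σ)) * (z - ((ω₀ : ℂ) - I * σ)) =
      (z - ω₀) ^ 2 + (σ : ℂ) ^ 2 := by
    intro z
    linear_combination (-(σ : ℂ) ^ 2) * hI
  simp only [hquad, hmI, sub_neg_eq_add] at iA iB eA eB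
  have e : (fun ω : ℝ => (ω : ℂ) /
        (((ω : ℂ) ^ 2 - lam ^ 2) * ((ω : ℂ) ^ 2 + (m : ℂ) ^ 2) *
          (((ω : ℂ) - ω₀) ^ 2 + (σ : ℂ) ^ 2))) = fun ω : ℝ =>
      1 / (lam ^ 2 + (m : ℂ) ^ 2) *
      ((ω : ℂ) / (((ω : ℂ) ^ 2 - lam ^ 2) * (((ω : ℂ) - ω₀) ^ 2 + (σ : ℂ) ^ 2)) -
       (ω : ℂ) / (((ω : ℂ) ^ 2 + (m : ℂ) ^ 2) * (((ω : ℂ) - ω₀) ^ 2 + (σ : ℂ) ^ 2))) := by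
    funext w
    have m1 : (w : ℂ) ^ 2 - lam ^ 2 ≠ 0 := by
      rw [sq_sub_sq]
      refine mul_ne_zero ?_ (aux_ne lam hlam.ne' w)
      simpa using aux_ne (-lam) (by simpa using hlam.ne') w
    have m2 : (w : ℂ) ^ 2 + (m : ℂ) ^ 2 ≠ 0 := by
      have : (0 : ℝ) < w ^ 2 + m ^ 2 := by positivity
      exact_mod_cast this.ne'
    have m3 : ((w : ℂ) - ω₀) ^ 2 + (σ : ℂ) ^ 2 ≠ 0 := by
      have : (0 : ℝ) < (w - ω₀) ^ 2 + σ ^ 2 := by positivity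
      exact_mod_cast this.ne'
    field_simp
    ring
  rw [e, integral_const_mul, integral_sub iA iB, eA, eB]
  have hs : (σ : ℂ) ≠ 0 := by exact_mod_cast hσ.ne'
  have n4 : (lam - ω₀) ^ 2 + (σ : ℂ) ^ 2 ≠ 0 := by
    rw [← hquad]
    refine mul_ne_zero (sub_ne_zero.mpr h2) ?_
    intro h; have := congrArg Complex.im h; simp at this; linarith
  have n5 : (I * m - ω₀) ^ 2 + (σ : ℂ) ^ 2 ≠ 0 := by
    rw [← hquad]
    refine mul_ne_zero (sub_ne_zero.mpr h3) ?_
    intro h; have := congrArg Complex.im h; simp at this; linarith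
  have e1 : ∀ x : ℂ, 2 * (π : ℂ) * I * ((ω₀ : ℂ) + I * σ) /
      (((ω₀ : ℂ) + I * σ - ((ω₀ : ℂ) - I * σ)) * x) = π * ((ω₀ : ℂ) + I * σ) / σ / x := by
    intro x
    have : (ω₀ : ℂ) + I * σ - ((ω₀ : ℂ) - I * σ) = 2 * I * σ := by ring
    rw [this]
    have := Complex.I_ne_zero
    by_cases hx : x = 0
    · simp [hx]
    field_simp
  rw [e1, e1]
  generalize (I * (m : ℂ) - ω₀) ^ 2 + (σ : ℂ) ^ 2 = B at *
  generalize (lam - (ω₀ : ℂ)) ^ 2 + (σ : ℂ) ^ 2 = A at *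
  generalize (ω₀ : ℂ) + I * σ = p at *
  field_simp
  ring
end
end

section
/- Let m > 0, σ > 0, ω₀ ∈ ℝ, and let λ ∈ ℂ with Im λ > 0 be such that the three points λ, im, ω₀ + iσ are pairwise distinct. Then ∫_{−∞}^{∞} ω³ / ((ω² − λ²)(ω² + m²)((ω − ω₀)² + σ²)) dω = πiλ²/((λ² + m²)((λ − ω₀)² + σ²)) + πim²/((λ² + m²)((im − ω₀)² + σ²)) + π(ω₀ + iσ)³/(σ·((ω₀ + iσ)² − λ²)·((ω₀ + iσ)² + m²)). -/
open Complex Real MeasureTheory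

noncomputable section

lemma aux_ne_s7 (p : ℂ) (hp : p.im ≠ 0) (x : ℝ) : (x : ℂ) - p ≠ 0 := by
  intro h
  apply hp
  have := congrArg Complex.im h
  simpa using this

lemma aux_int1 (p : ℂ) (hp : p.im ≠ 0) :
    Integrable (fun x : ℝ => (‖(x : ℂ) - p‖ ^ 2)⁻¹) := by
  have h := ((integrable_inv_one_add_sq.comp_div hp).comp_sub_right p.re).const_mul ((p.im ^ 2)⁻¹)
  refine h.congr (Filter.Eventually.of_forall fun x => ?_)
  simp only
  rw [← Complex.normSq_eq_norm_sq, Complex.normSq_apply, ← mul_inv]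
  congr 1
  simp
  field_simp
  ring

lemma aux_int_s7 (p q : ℂ) (hp : p.im ≠ 0) (hq : q.im ≠ 0) :
    Integrable (fun x : ℝ => 1 / (((x : ℂ) - p) * ((x : ℂ) - q))) := by
  refine ((aux_int1 p hp).add (aux_int1 q hq)).mono' ?_ ?_
  · apply Continuous.aestronglyMeasurable
    apply Continuous.div (by fun_prop) (by fun_prop)
    intro x
    exact mul_ne_zero (aux_ne_s7 p hp x) (aux_ne_s7 q hq x)
  · refine Filter.Eventually.of_forall fun x => ?_
    simp only [Pi.add_apply, one_div, mul_inv, norm_mul, norm_inv, ← inv_pow]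
    nlinarith [sq_nonneg (‖(x : ℂ) - p‖⁻¹ - ‖(x : ℂ) - q‖⁻¹), sq_nonneg (‖(x : ℂ) - p‖⁻¹),
      sq_nonneg (‖(x : ℂ) - q‖⁻¹)]

lemma aux_top_s7 (s p : ℂ) (hs : s ∈ slitPlane) :
    Filter.Tendsto (fun x : ℝ => Complex.log (s * ((x : ℂ) - p)) - (Real.log x : ℂ))
      Filter.atTop (nhds (Complex.log s)) := by
  have h1 : Filter.Tendsto (fun x : ℝ => s * (1 - p * ((x⁻¹ : ℝ) : ℂ))) Filter.atTop (nhds s) := by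
    have h0 : Filter.Tendsto (fun x : ℝ => ((x⁻¹ : ℝ) : ℂ)) Filter.atTop (nhds ((0 : ℝ) : ℂ)) :=
      (Complex.continuous_ofReal.tendsto 0).comp tendsto_inv_atTop_zero
    have := ((h0.const_mul p).const_sub 1).const_mul s
    simpa using this
  have h2 := h1.clog hs
  refine h2.congr' ?_
  have hne : ∀ᶠ x : ℝ in Filter.atTop, s * (1 - p * ((x⁻¹ : ℝ) : ℂ)) ≠ 0 :=
    h1.eventually_ne (slitPlane_ne_zero hs)
  filter_upwards [Filter.eventually_gt_atTop 0, hne] with x hx hx'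
  have hxc : (x : ℂ) ≠ 0 := by exact_mod_cast hx.ne'
  have : s * ((x : ℂ) - p) = (x : ℂ) * (s * (1 - p * ((x⁻¹ : ℝ) : ℂ))) := by
    push_cast
    field_simp
  rw [this, Complex.log_ofReal_mul hx hx']
  ring

lemma aux_bot (s p : ℂ) (hs : -s ∈ slitPlane) :
    Filter.Tendsto (fun x : ℝ => Complex.log (s * ((x : ℂ) - p)) - (Real.log x : ℂ))
      Filter.atBot (nhds (Complex.log (-s))) := by
  have := (aux_top_s7 (-s) (-p) hs).comp Filter.tendsto_neg_atBot_atTop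
  refine this.congr fun x => ?_
  simp only [Function.comp, Real.log_neg_eq_log]
  congr 2
  push_cast
  ring

lemma aux_deriv (s p : ℂ) (h : 0 < (s * -p).re) (hs : s.re = 0) (hs0 : s ≠ 0) (x : ℝ) :
    HasDerivAt (fun x : ℝ => Complex.log (s * ((x : ℂ) - p))) (1 / ((x : ℂ) - p)) x := by
  have h1 : HasDerivAt (fun x : ℝ => s * ((x : ℂ) - p)) (s * 1) x :=
    ((Complex.ofRealCLM.hasDerivAt (x := x)).sub_const p).const_mul s
  have h2 : s * ((x : ℂ) - p) ∈ slitPlane := by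
    left
    simp [hs] at h ⊢
    linarith
  have h3 := h1.clog_real h2
  convert h3 using 1
  field_simp

lemma aux_main (s t p q : ℂ) (hpq : p ≠ q) (hp : p.im ≠ 0) (hq : q.im ≠ 0)
    (h : 0 < (s * -p).re) (hs : s.re = 0) (hs0 : s.im ≠ 0)
    (h' : 0 < (t * -q).re) (ht : t.re = 0) (ht0 : t.im ≠ 0) :
    ∫ x : ℝ, 1 / (((x : ℂ) - p) * ((x : ℂ) - q)) =
      ((Complex.log s - Complex.log t) - (Complex.log (-s) - Complex.log (-t))) / (p - q) := by
  have hs1 : s ≠ 0 := fun h => hs0 (by simp [h])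
  have ht1 : t ≠ 0 := fun h => ht0 (by simp [h])
  have hd : p - q ≠ 0 := sub_ne_zero.mpr hpq
  rw [sub_div]
  apply integral_of_hasDerivAt_of_tendsto
    (f := fun x : ℝ => (Complex.log (s * ((x : ℂ) - p)) - Complex.log (t * ((x : ℂ) - q))) / (p - q))
  · intro x
    have := ((aux_deriv s p h hs hs1 x).sub (aux_deriv t q h' ht ht1 x)).div_const (p - q)
    refine HasDerivAt.congr_deriv this ?_
    have := aux_ne_s7 p hp x
    have := aux_ne_s7 q hq x
    field_simp
    ring
  · exact aux_int_s7 p q hp hq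
  · have := ((aux_bot s p (Or.inr (by simpa using hs0))).sub
      (aux_bot t q (Or.inr (by simpa using ht0)))).div_const (p - q)
    simpa using this
  · have := ((aux_top_s7 s p (Or.inr hs0)).sub (aux_top_s7 t q (Or.inr ht0))).div_const (p - q)
    simpa using this

lemma aux_up (p q : ℂ) (hp : 0 < p.im) (hq : q.im < 0) :
    ∫ x : ℝ, 1 / (((x : ℂ) - p) * ((x : ℂ) - q)) = 2 * π * I / (p - q) := by
  rw [aux_main I (-I) p q (by rintro rfl; linarith) hp.ne' hq.ne (by simpa using hp) (by simp)
    (by simp) (by simpa using hq) (by simp) (by simp)]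
  rw [neg_neg, Complex.log_I, Complex.log_neg_I]
  ring

lemma aux_low (p q : ℂ) (hp : p.im < 0) (hq : q.im < 0) :
    ∫ x : ℝ, 1 / (((x : ℂ) - p) * ((x : ℂ) - q)) = 0 := by
  by_cases hpq : p = q
  · subst hpq
    rw [← sub_self (0 : ℂ)]
    have ht : Filter.Tendsto (fun x : ℝ => -((x : ℂ) - p)⁻¹) (Filter.cocompact ℝ) (nhds 0) := by
      rw [← neg_zero]
      apply Filter.Tendsto.neg
      apply Filter.tendsto_inv₀_cobounded.comp
      rw [← tendsto_norm_atTop_iff_cobounded]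
      have : Filter.Tendsto (fun x : ℝ => ‖x‖ + -‖p‖) (Filter.cocompact ℝ) Filter.atTop :=
        Filter.tendsto_atTop_add_const_right _ _ (tendsto_norm_cocompact_atTop)
      refine Filter.tendsto_atTop_mono (fun x => ?_) this
      have := norm_sub_norm_le (x : ℂ) p
      rw [Complex.norm_real] at this
      linarith
    apply integral_of_hasDerivAt_of_tendsto (f := fun x : ℝ => -((x : ℂ) - p)⁻¹)
    · intro x
      have h1 : HasDerivAt (fun x : ℝ => ((x : ℂ) - p)) 1 x :=
        ((Complex.ofRealCLM.hasDerivAt (x := x)).sub_const p)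
      have := (h1.inv (aux_ne_s7 p hp.ne x)).neg
      refine HasDerivAt.congr_deriv this ?_
      have := aux_ne_s7 p hp.ne x
      field_simp
    · exact aux_int_s7 p p hp.ne hp.ne
    · exact ht.mono_left atBot_le_cocompact
    · exact ht.mono_left atTop_le_cocompact
  · rw [aux_main (-I) (-I) p q hpq hp.ne hq.ne (by simpa using hp) (by simp)
      (by simp) (by simpa using hq) (by simp) (by simp)]
    simp

lemma aux_pf (z a b c d e : ℂ) (hab : a - b ≠ 0) (hac : a - c ≠ 0) (had : a - d ≠ 0)
    (hae : a - e ≠ 0) (hbc : b - c ≠ 0) (hbd : b - d ≠ 0) (hbe : b - e ≠ 0) (hcd : c - d ≠ 0)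
    (hce : c - e ≠ 0) (hde : d - e ≠ 0)
    (ha : z - a ≠ 0) (hb : z - b ≠ 0) (hc : z - c ≠ 0) (hd : z - d ≠ 0) (he : z - e ≠ 0) :
    z ^ 3 / ((z - a) * (z - b) * (z - c) * (z - d) * (z - e)) =
      a ^ 3 / ((a - b) * (a - c) * (a - d) * (a - e)) * (1 / (z - a))
      - b ^ 3 / ((a - b) * (b - c) * (b - d) * (b - e)) * (1 / (z - b))
      + c ^ 3 / ((a - c) * (b - c) * (c - d) * (c - e)) * (1 / (z - c))
      - d ^ 3 / ((a - d) * (b - d) * (c - d) * (d - e)) * (1 / (z - d))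
      + e ^ 3 / ((a - e) * (b - e) * (c - e) * (d - e)) * (1 / (z - e)) := by
  field_simp
  ring

lemma aux_lin (f g h k l : ℝ → ℂ) (hf : Integrable f) (hg : Integrable g) (hh : Integrable h)
    (hk : Integrable k) (hl : Integrable l) :
    ∫ x, (f x - g x + h x - k x + l x) =
      (∫ x, f x) - (∫ x, g x) + (∫ x, h x) - (∫ x, k x) + ∫ x, l x := by
  have h1 : Integrable (fun x => f x - g x) := hf.sub hg
  have h2 : Integrable (fun x => f x - g x + h x) := h1.add hh
  have h3 : Integrable (fun x => f x - g x + h x - k x) := h2.sub hk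
  rw [integral_add h3 hl, integral_sub h2 hk, integral_add h1 hh, integral_sub hf hg]

lemma aux_total (a b c d e q : ℂ) (ha : 0 < a.im) (hb : 0 < b.im) (hc : 0 < c.im)
    (hd : d.im < 0) (he : e.im < 0) (hq : q.im < 0)
    (hab : a - b ≠ 0) (hac : a - c ≠ 0) (hbc : b - c ≠ 0) (hde : d - e ≠ 0) :
    ∫ x : ℝ, (x : ℂ) ^ 3 / (((x : ℂ) - a) * ((x : ℂ) - b) * ((x : ℂ) - c) * ((x : ℂ) - d) *
        ((x : ℂ) - e) * ((x : ℂ) - q)) =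
      a ^ 3 / ((a - b) * (a - c) * (a - d) * (a - e)) * (2 * π * I / (a - q))
      - b ^ 3 / ((a - b) * (b - c) * (b - d) * (b - e)) * (2 * π * I / (b - q))
      + c ^ 3 / ((a - c) * (b - c) * (c - d) * (c - e)) * (2 * π * I / (c - q)) := by
  have key : ∀ u v : ℂ, 0 < u.im → v.im < 0 → u - v ≠ 0 := by
    intro u v hu hv h
    rw [sub_eq_zero.mp h] at hu
    linarith
  have hfun : ∀ x : ℝ, (x : ℂ) ^ 3 / (((x : ℂ) - a) * ((x : ℂ) - b) * ((x : ℂ) - c) *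
      ((x : ℂ) - d) * ((x : ℂ) - e) * ((x : ℂ) - q)) =
      a ^ 3 / ((a - b) * (a - c) * (a - d) * (a - e)) * (1 / (((x : ℂ) - a) * ((x : ℂ) - q)))
      - b ^ 3 / ((a - b) * (b - c) * (b - d) * (b - e)) * (1 / (((x : ℂ) - b) * ((x : ℂ) - q)))
      + c ^ 3 / ((a - c) * (b - c) * (c - d) * (c - e)) * (1 / (((x : ℂ) - c) * ((x : ℂ) - q)))
      - d ^ 3 / ((a - d) * (b - d) * (c - d) * (d - e)) * (1 / (((x : ℂ) - d) * ((x : ℂ) - q)))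
      + e ^ 3 / ((a - e) * (b - e) * (c - e) * (d - e)) *
        (1 / (((x : ℂ) - e) * ((x : ℂ) - q))) := by
    intro x
    rw [← div_div, aux_pf x a b c d e hab hac (key _ _ ha hd) (key _ _ ha he) hbc
      (key _ _ hb hd) (key _ _ hb he) (key _ _ hc hd) (key _ _ hc he) hde
      (aux_ne_s7 a ha.ne' x) (aux_ne_s7 b hb.ne' x) (aux_ne_s7 c hc.ne' x) (aux_ne_s7 d hd.ne x)
      (aux_ne_s7 e he.ne x)]
    simp only [← div_div (1 : ℂ)]
    ring
  simp_rw [hfun]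
  have ia := aux_int_s7 a q ha.ne' hq.ne
  have ib := aux_int_s7 b q hb.ne' hq.ne
  have ic := aux_int_s7 c q hc.ne' hq.ne
  have id' := aux_int_s7 d q hd.ne hq.ne
  have ie := aux_int_s7 e q he.ne hq.ne
  rw [aux_lin _ _ _ _ _ (ia.const_mul _) (ib.const_mul _) (ic.const_mul _) (id'.const_mul _)
    (ie.const_mul _)]
  simp only [integral_const_mul]
  rw [aux_up a q ha hq, aux_up b q hb hq, aux_up c q hc hq, aux_low d q hd hq, aux_low e q he hq]
  ring

/-- residue evaluation of
∫ ω³/((ω² − λ²)(ω² + m²)((ω − ω₀)² + σ²)) dω over ℝ. -/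
theorem stmt7 (m σ ω₀ : ℝ) (hm : 0 < m) (hσ : 0 < σ) (lam : ℂ)
    (hlam : 0 < lam.im)
    (h1 : lam ≠ I * m) (h2 : lam ≠ (ω₀ : ℂ) + I * σ)
    (h3 : I * (m : ℂ) ≠ (ω₀ : ℂ) + I * σ) :
    ∫ ω : ℝ, (ω : ℂ) ^ 3 /
        (((ω : ℂ) ^ 2 - lam ^ 2) * ((ω : ℂ) ^ 2 + (m : ℂ) ^ 2) *
          (((ω : ℂ) - ω₀) ^ 2 + (σ : ℂ) ^ 2))
      = (π : ℂ) * I * lam ^ 2 /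
            ((lam ^ 2 + (m : ℂ) ^ 2) * ((lam - ω₀) ^ 2 + (σ : ℂ) ^ 2))
        + (π : ℂ) * I * (m : ℂ) ^ 2 /
            ((lam ^ 2 + (m : ℂ) ^ 2) * ((I * m - ω₀) ^ 2 + (σ : ℂ) ^ 2))
        + (π : ℂ) * ((ω₀ : ℂ) + I * σ) ^ 3 /
            ((σ : ℂ) * (((ω₀ : ℂ) + I * σ) ^ 2 - lam ^ 2) *
              (((ω₀ : ℂ) + I * σ) ^ 2 + (m : ℂ) ^ 2)) := by
  have hI : I ^ 2 = -1 := I_sq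
  have hab : lam - I * m ≠ 0 := sub_ne_zero.mpr h1
  have hac : lam - (ω₀ + I * σ) ≠ 0 := sub_ne_zero.mpr h2
  have hbc : I * m - (ω₀ + I * σ) ≠ 0 := sub_ne_zero.mpr h3
  have key : ∀ u v : ℂ, 0 < u.im → v.im < 0 → u - v ≠ 0 := by
    intro u v hu hv h
    rw [sub_eq_zero.mp h] at hu
    linarith
  have hde : (-(I * m) : ℂ) - (ω₀ - I * σ) ≠ 0 := by
    intro h
    apply hbc
    have hr := congrArg Complex.re h
    have hi := congrArg Complex.im h
    simp at hr hi
    apply Complex.ext <;> simp <;> linarith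
  have imb : 0 < (I * (m : ℂ)).im := by simpa using hm
  have imc : 0 < ((ω₀ : ℂ) + I * σ).im := by simpa using hσ
  have imd : (-(I * (m : ℂ))).im < 0 := by simpa using hm
  have ime : ((ω₀ : ℂ) - I * σ).im < 0 := by simpa using hσ
  have imq : (-lam).im < 0 := by simpa using hlam
  have T := aux_total lam (I * m) (ω₀ + I * σ) (-(I * m)) (ω₀ - I * σ) (-lam)
    hlam imb imc imd ime imq hab hac hbc hde
  have n1 := key _ _ hlam imd
  have n2 := key _ _ hlam ime
  have n3 := key _ _ hlam imq
  have n4 := key _ _ imb imd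
  have n5 := key _ _ imb ime
  have n6 := key _ _ imb imq
  have n7 := key _ _ imc imd
  have n8 := key _ _ imc ime
  have n9 := key _ _ imc imq
  have hmc : (m : ℂ) ≠ 0 := by exact_mod_cast hm.ne'
  have hsc : (σ : ℂ) ≠ 0 := by exact_mod_cast hσ.ne'
  have hl0 : lam ≠ 0 := by rintro rfl; simp at hlam
  have e1 : lam ^ 2 + (m : ℂ) ^ 2 = (lam - I * m) * (lam - -(I * m)) := by
    linear_combination ((m : ℂ) ^ 2) * hI
  have e2 : ∀ z : ℂ, (z - ω₀) ^ 2 + (σ : ℂ) ^ 2 = (z - (ω₀ + I * σ)) * (z - (ω₀ - I * σ)) := by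
    intro z
    linear_combination ((σ : ℂ) ^ 2) * hI
  have e3 : ∀ z : ℂ, z ^ 2 + (m : ℂ) ^ 2 = (z - I * m) * (z - -(I * m)) := by
    intro z
    linear_combination ((m : ℂ) ^ 2) * hI
  have e4 : ∀ z : ℂ, z ^ 2 - lam ^ 2 = (z - lam) * (z - -lam) := by
    intro z
    ring
  have hL : ∀ x : ℝ, (x : ℂ) ^ 3 /
        (((x : ℂ) ^ 2 - lam ^ 2) * ((x : ℂ) ^ 2 + (m : ℂ) ^ 2) *
          (((x : ℂ) - ω₀) ^ 2 + (σ : ℂ) ^ 2)) =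
      (x : ℂ) ^ 3 / (((x : ℂ) - lam) * ((x : ℂ) - I * m) * ((x : ℂ) - (ω₀ + I * σ)) *
        ((x : ℂ) - -(I * m)) * ((x : ℂ) - (ω₀ - I * σ)) * ((x : ℂ) - -lam)) := by
    intro x
    rw [e2, e3, e4]
    congr 1
    ring
  simp_rw [hL]
  rw [T, e2, e2, e3, e3, e4]
  have s1 : lam - -lam = 2 * lam := by ring
  have s2 : I * (m : ℂ) - -(I * m) = 2 * I * m := by ring
  have s3 : (ω₀ : ℂ) + I * σ - (ω₀ - I * σ) = 2 * I * σ := by ring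
  rw [s1, s2, s3]
  congr 1
  · rw [sub_eq_add_neg]
    congr 1
    · generalize lam - I * m = A at *
      generalize lam - -(I * m) = B at *
      generalize lam - (ω₀ + I * σ) = C at *
      generalize lam - (ω₀ - I * σ) = D at *
      field_simp
    · rw [show I * (m : ℂ) - -lam = lam - -(I * m) by ring]
      generalize lam - I * m = A at *
      generalize lam - -(I * m) = B at *
      generalize I * m - (ω₀ + I * σ) = C at *
      generalize I * m - (ω₀ - I * σ) = D at *
      have hI0 : I ≠ 0 := I_ne_zero
      field_simp
      linear_combination (-1 : ℂ) * hI
  · rw [show (ω₀ : ℂ) + I * σ - lam = -(lam - (ω₀ + I * σ)) by ring,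
      show (ω₀ : ℂ) + I * σ - I * m = -(I * m - (ω₀ + I * σ)) by ring]
    generalize lam - (ω₀ + I * σ) = A at *
    generalize I * m - (ω₀ + I * σ) = B at *
    generalize (ω₀ : ℂ) + I * σ - -lam = C at *
    generalize (ω₀ : ℂ) + I * σ - -(I * m) = D at *
    have hI0 : I ≠ 0 := I_ne_zero
    field_simp
end
end

section
/- Let n ≥ 1, let m₁, …, m_n be distinct positive reals, let σ > 0 and ω₀ ∈ ℝ be such that the points im₁, …, im_n, ω₀ + iσ are pairwise distinct, and let p ∈ ℂ[X] be a polynomial of degree at most n. Then there exist complex constants c_k, d_k (1 ≤ k ≤ n) and a₀, a₁, a₂, a₃, all independent of λ, such that for every λ ∈ ℂ with Im λ > 0 and λ ∉ {im₁, …, im_n, ω₀ + iσ, −ω₀ + iσ}: ∫_{−∞}^{∞} ω·p(ω²) / ((ω² − λ²)·((ω − ω₀)² + σ²)·∏_{k=1}^{n}(ω² + m_k²)) dω = Σ_{k=1}^{n} (c_k + d_k λ)/(λ² + m_k²) + (a₀ + a₁λ + a₂λ² + a₃λ³)/((ω₀² − σ² − λ²)² + 4ω₀²σ²). -/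
open Complex Real MeasureTheory Finset

noncomputable section

lemma lbnd (a : ℂ) (ha : 0 < a.im) : ∃ C : ℝ, 0 < C ∧ ∀ w : ℝ, 1 + w^2 ≤ C * ‖(w:ℂ)^2 - a^2‖ := by
  have key : ∃ C : ℝ, 0 < C ∧ ∀ u : ℝ, u^2 = a.re^2 → ∀ w : ℝ, 1 + w^2 ≤ C * ((w-u)^2 + a.im^2) := by
    refine ⟨2 + (1 + 2 * a.re^2)/a.im^2, by positivity, fun u hu w => ?_⟩
    have h1 : (1 + 2 * a.re^2)/a.im^2 * a.im^2 = 1 + 2 * a.re^2 := by field_simp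
    have h2 : 0 ≤ (1 + 2 * a.re^2)/a.im^2 * (w-u)^2 := by positivity
    nlinarith [sq_nonneg (w - 2*u), sq_nonneg a.im]
  obtain ⟨C, hC, h⟩ := key
  refine ⟨C, hC, fun w => ?_⟩
  have e1 : ‖(w:ℂ) - a‖^2 = (w - a.re)^2 + a.im^2 := by
    rw [Complex.sq_norm, Complex.normSq_apply]; simp; ring
  have e2 : ‖(w:ℂ) + a‖^2 = (w - (-a.re))^2 + a.im^2 := by
    rw [Complex.sq_norm, Complex.normSq_apply]; simp; ring
  have h1 := h a.re rfl w
  have h2 := h (-a.re) (by ring) w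
  rw [← e1] at h1
  rw [← e2] at h2
  have e3 : (w:ℂ)^2 - a^2 = (w - a) * (w + a) := by ring
  rw [e3, norm_mul]
  have : (1 + w^2)^2 ≤ (C * (‖(w:ℂ) - a‖ * ‖(w:ℂ) + a‖))^2 := by
    calc (1 + w^2)^2 = (1 + w^2) * (1+w^2) := by ring
      _ ≤ (C * ‖(w:ℂ) - a‖^2) * (C * ‖(w:ℂ) + a‖^2) := by gcongr
      _ = _ := by ring
  exact le_of_sq_le_sq this (by positivity)

lemma sub_ne (a : ℂ) (ha : 0 < a.im) (w : ℝ) : (w:ℂ)^2 - a^2 ≠ 0 := by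
  obtain ⟨C, hC, h⟩ := lbnd a ha
  intro h0
  have := h w
  rw [h0] at this
  simp at this
  nlinarith [sq_nonneg w]

lemma intg (a : ℂ) (ha : 0 < a.im) : Integrable (fun w : ℝ => 1 / ((w:ℂ)^2 - a^2)) := by
  obtain ⟨C, hC, h⟩ := lbnd a ha
  refine (integrable_inv_one_add_sq.const_mul C).mono' ?_ ?_
  · exact Measurable.aestronglyMeasurable (by fun_prop)
  · refine Filter.Eventually.of_forall fun w => ?_
    have hp : 0 < ‖(w:ℂ)^2 - a^2‖ := norm_pos_iff.2 (sub_ne a ha w)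
    rw [norm_div, norm_one, ← div_eq_mul_inv, div_le_div_iff₀ hp (by positivity)]
    linarith [h w]

lemma integ (a : ℂ) (ha : 0 < a.im) : ∫ w : ℝ, 1 / ((w:ℂ)^2 - a^2) = π * I / a := by
  have ha0 : a ≠ 0 := by rintro rfl; simp at ha
  let L : ℝ → ℂ := fun w => Complex.log (w - a) - Complex.log (w + a)
  have hs1 : ∀ w : ℝ, (w:ℂ) - a ∈ slitPlane := fun w => Or.inr (by simp; exact ha.ne')
  have hs2 : ∀ w : ℝ, (w:ℂ) + a ∈ slitPlane := fun w => Or.inr (by simp; exact ha.ne')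
  have hd : ∀ w : ℝ, HasDerivAt (fun w => L w / (2 * a)) (1 / ((w:ℂ)^2 - a^2)) w := by
    intro w
    have d0 : HasDerivAt (fun w : ℝ => (w:ℂ)) 1 w := Complex.ofRealCLM.hasDerivAt
    have d1 := (d0.sub_const a).clog_real (hs1 w)
    have d2 := (d0.add_const a).clog_real (hs2 w)
    have n1 := slitPlane_ne_zero (hs1 w)
    have n2 := slitPlane_ne_zero (hs2 w)
    have e : 1 / ((w:ℂ)^2 - a^2) = (1 / (w - a) - 1 / (w + a)) / (2 * a) := by
      have : (w:ℂ)^2 - a^2 = (w - a) * (w + a) := by ring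
      rw [this]
      field_simp
      ring
    rw [e]
    exact (d1.sub d2).div_const (2*a)
  have hT : Filter.Tendsto L Filter.atTop (nhds 0) := by
    have hz : Filter.Tendsto (fun w : ℝ => a / (w:ℂ)) Filter.atTop (nhds 0) := by
      have := (Complex.continuous_ofReal.tendsto 0).comp tendsto_inv_atTop_zero
      have := this.const_mul a
      simpa [div_eq_mul_inv, Function.comp_def] using this
    have c : ContinuousAt Complex.log 1 := continuousAt_clog (by simp)
    have h1 : Filter.Tendsto (fun w : ℝ => Complex.log (1 - a / (w:ℂ))) Filter.atTop (nhds (Complex.log 1)) :=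
      c.tendsto.comp (by simpa using hz.const_sub 1)
    have h2 : Filter.Tendsto (fun w : ℝ => Complex.log (1 + a / (w:ℂ))) Filter.atTop (nhds (Complex.log 1)) :=
      c.tendsto.comp (by simpa using hz.const_add 1)
    have h3 := h1.sub h2
    rw [sub_self] at h3
    refine h3.congr' ?_
    filter_upwards [Filter.eventually_gt_atTop 0] with w hw
    have hw0 : (w:ℂ) ≠ 0 := by exact_mod_cast hw.ne'
    have e1 : (w:ℂ) - a = w * (1 - a / w) := by field_simp
    have e2 : (w:ℂ) + a = w * (1 + a / w) := by field_simp
    have n1 : 1 - a / w ≠ 0 := fun h => slitPlane_ne_zero (hs1 w) (by rw [e1, h, mul_zero])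
    have n2 : 1 + a / w ≠ 0 := fun h => slitPlane_ne_zero (hs2 w) (by rw [e2, h, mul_zero])
    simp only [L]
    rw [e1, e2, Complex.log_ofReal_mul hw n1, Complex.log_ofReal_mul hw n2]
    ring
  have hneg : ∀ w : ℝ, L (-w) = - L w - 2 * π * I := by
    intro w
    simp only [L]
    have e1 : ((-w : ℝ) : ℂ) - a = -(w + a) := by push_cast; ring
    have e2 : ((-w : ℝ) : ℂ) + a = -(w - a) := by push_cast; ring
    rw [e1, e2]
    simp only [Complex.log, norm_neg]
    rw [Complex.arg_neg_eq_arg_sub_pi_of_im_pos (x := (w:ℂ) + a) (by simpa using ha),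
      Complex.arg_neg_eq_arg_add_pi_of_im_neg (x := (w:ℂ) - a) (by simpa using ha)]
    push_cast
    ring
  have hB : Filter.Tendsto L Filter.atBot (nhds (- 2 * π * I)) := by
    have := ((hT.comp Filter.tendsto_neg_atBot_atTop).neg).sub_const (2 * π * I)
    have h2 : (-0 - 2 * π * I : ℂ) = - 2 * π * I := by ring
    rw [h2] at this
    refine this.congr fun w => ?_
    have := hneg (-w)
    rw [neg_neg] at this
    rw [this]; rfl
  rw [integral_of_hasDerivAt_of_tendsto hd (intg a ha) (hB.div_const _) (hT.div_const _)]
  field_simp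
  ring

lemma integ2 (a l : ℂ) (ha : 0 < a.im) (hl : 0 < l.im) (hne : l ≠ a) :
    Integrable (fun w : ℝ => (w:ℂ)^2 / (((w:ℂ)^2 - a^2) * ((w:ℂ)^2 - l^2))) ∧
    ∫ w : ℝ, (w:ℂ)^2 / (((w:ℂ)^2 - a^2) * ((w:ℂ)^2 - l^2)) = π * I / (a + l) := by
  have ha0 : a ≠ 0 := by rintro rfl; simp at ha
  have hl0 : l ≠ 0 := by rintro rfl; simp at hl
  have h1 : a + l ≠ 0 := by
    intro h
    have := congrArg Complex.im h
    simp at this; linarith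
  have h2 : a - l ≠ 0 := sub_ne_zero.2 hne.symm
  have e : (fun w : ℝ => (w:ℂ)^2 / (((w:ℂ)^2 - a^2) * ((w:ℂ)^2 - l^2))) =
      fun w : ℝ => (a^2 / ((a+l)*(a-l))) * (1 / ((w:ℂ)^2 - a^2)) - (l^2 / ((a+l)*(a-l))) * (1 / ((w:ℂ)^2 - l^2)) := by
    funext w
    have := sub_ne a ha w
    have := sub_ne l hl w
    field_simp
    ring
  rw [e]
  have i1 := (intg a ha).const_mul (a^2 / ((a+l)*(a-l)))
  have i2 := (intg l hl).const_mul (l^2 / ((a+l)*(a-l)))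
  refine ⟨i1.sub i2, ?_⟩
  rw [integral_sub i1 i2, integral_const_mul, integral_const_mul, integ a ha, integ l hl]
  field_simp

lemma pbnd (n : ℕ) (m : Fin n → ℝ) (hm : ∀ k, 0 < m k) (p : Polynomial ℂ) (hp : p.degree ≤ n) :
    ∃ M : ℝ, 0 ≤ M ∧ ∀ w : ℝ, ‖p.eval ((w:ℂ)^2)‖ ≤ M * ‖∏ k, ((w : ℂ) ^ 2 + (m k : ℂ) ^ 2)‖ := by
  refine ⟨(∑ i ∈ range (n+1), ‖p.coeff i‖) * ∏ k, (1 + 1 / (m k)^2), ?_, fun w => ?_⟩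
  · have : ∀ k, 0 ≤ (1 + 1 / (m k)^2) := fun k => by positivity
    exact mul_nonneg (sum_nonneg fun i _ => norm_nonneg _) (prod_nonneg fun k _ => this k)
  · have hpn : p.natDegree < n + 1 := Nat.lt_succ_of_le (Polynomial.natDegree_le_of_degree_le hp)
    rw [Polynomial.eval_eq_sum_range' hpn]
    have h1 : ‖∑ i ∈ range (n+1), p.coeff i * ((w:ℂ)^2)^i‖ ≤ ∑ i ∈ range (n+1), ‖p.coeff i‖ * (1 + w^2)^n := by
      refine norm_sum_le_of_le _ fun i hi => ?_
      rw [norm_mul, norm_pow, norm_pow, Complex.norm_real, Real.norm_eq_abs, sq_abs]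
      gcongr
      have hi : i ≤ n := Nat.lt_succ_iff.1 (mem_range.1 hi)
      calc (w^2)^i ≤ (1+w^2)^i := by gcongr; linarith
        _ ≤ _ := pow_le_pow_right₀ (by nlinarith [sq_nonneg w]) hi
    refine h1.trans ?_
    rw [← sum_mul, mul_assoc]
    refine mul_le_mul_of_nonneg_left ?_ (sum_nonneg fun i _ => norm_nonneg _)
    rw [norm_prod, ← prod_mul_distrib]
    have : (1 + w^2)^n = ∏ k : Fin n, (1 + w^2) := by simp
    rw [this]
    refine prod_le_prod (fun _ _ => by positivity) fun k _ => ?_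
    have hk := hm k
    have : ((w : ℂ) ^ 2 + (m k : ℂ) ^ 2) = ((w^2 + (m k)^2 : ℝ) : ℂ) := by push_cast; ring
    rw [this, Complex.norm_real, Real.norm_eq_abs, abs_of_pos (by positivity)]
    have h3 : 1 / (m k)^2 * (m k)^2 = 1 := by field_simp
    have h4 : 0 ≤ 1 / (m k)^2 * w^2 := by positivity
    nlinarith [sq_nonneg (m k)]

lemma rbnd (u v : ℝ) (hv : 0 < v) :
    ∃ C : ℝ, 0 < C ∧ ∀ w : ℝ, 1 + w^2 ≤ C * ((w-u)^2 + v^2) := by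
  refine ⟨2 + (1 + 2 * u^2)/v^2, by positivity, fun w => ?_⟩
  have h1 : (1 + 2 * u^2)/v^2 * v^2 = 1 + 2 * u^2 := by field_simp
  have h2 : 0 ≤ (1 + 2 * u^2)/v^2 * (w-u)^2 := by positivity
  nlinarith [sq_nonneg (w - 2*u), sq_nonneg v]

lemma intf (n : ℕ) (m : Fin n → ℝ) (hm : ∀ k, 0 < m k) (σ ω₀ : ℝ) (hσ : 0 < σ)
    (p : Polynomial ℂ) (hp : p.degree ≤ n) (lam : ℂ) (hl : 0 < lam.im) :
    Integrable (fun ω : ℝ => (ω : ℂ) * p.eval ((ω : ℂ) ^ 2) /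
            (((ω : ℂ) ^ 2 - lam ^ 2) * (((ω : ℂ) - ω₀) ^ 2 + (σ : ℂ) ^ 2) *
              ∏ k, ((ω : ℂ) ^ 2 + (m k : ℂ) ^ 2))) := by
  obtain ⟨C, hC, h⟩ := lbnd lam hl
  obtain ⟨C', hC', h'⟩ := rbnd ω₀ σ hσ
  obtain ⟨M, hM, hp'⟩ := pbnd n m hm p hp
  refine (integrable_inv_one_add_sq.const_mul (M * C * C')).mono' ?_ ?_
  · have := p.continuous.measurable
    have h2 : Measurable fun ω : ℝ => p.eval ((ω : ℂ) ^ 2) := this.comp (by fun_prop)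
    exact Measurable.aestronglyMeasurable (by fun_prop)
  · refine Filter.Eventually.of_forall fun w => ?_
    have h0 : 0 < ‖(w:ℂ)^2 - lam^2‖ := norm_pos_iff.2 (sub_ne lam hl w)
    have e1 : ((w : ℂ) - ω₀) ^ 2 + (σ : ℂ) ^ 2 = (((w - ω₀)^2 + σ^2 : ℝ) : ℂ) := by push_cast; ring
    have hq : 0 < (w - ω₀)^2 + σ^2 := by positivity
    have h3 : 0 < ‖∏ k, ((w : ℂ) ^ 2 + (m k : ℂ) ^ 2)‖ := by
      rw [norm_pos_iff, prod_ne_zero_iff]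
      intro k _
      have hk := hm k
      have : ((w : ℂ) ^ 2 + (m k : ℂ) ^ 2) = ((w^2 + (m k)^2 : ℝ) : ℂ) := by push_cast; ring
      rw [this]
      have : w^2 + (m k)^2 ≠ 0 := by positivity
      exact_mod_cast this
    rw [norm_div, norm_mul, norm_mul, norm_mul, e1, Complex.norm_real, Complex.norm_real,
      Real.norm_of_nonneg hq.le, Real.norm_eq_abs, ← div_eq_mul_inv,
      div_le_div_iff₀ (by positivity) (by positivity)]
    have hw : |w| ≤ 1 + w^2 := by
      rw [← sq_abs]; nlinarith [sq_nonneg (|w| - 1), abs_nonneg w]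
    calc |w| * ‖p.eval ((w:ℂ)^2)‖ * (1 + w^2)
        ≤ (C' * ((w - ω₀)^2 + σ^2)) * (M * ‖∏ k, ((w : ℂ) ^ 2 + (m k : ℂ) ^ 2)‖) * (C * ‖(w:ℂ)^2 - lam^2‖) := by
          gcongr
          · exact hw.trans (h' w)
          · exact hp' w
          · exact h w
      _ = _ := by ring

lemma pfrac {ι : Type*} [Fintype ι] [DecidableEq ι] (v : ι → ℂ) (hv : Function.Injective v)
    (p : Polynomial ℂ) (hp : p.degree < Fintype.card ι) :
    ∃ B : ι → ℂ, ∀ x, (∀ i, x ≠ v i) → p.eval x / ∏ i, (x - v i) = ∑ i, B i / (x - v i) := by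
  refine ⟨fun i => Lagrange.nodalWeight univ v i * p.eval (v i), fun x hx => ?_⟩
  have h1 := Lagrange.eq_interpolate (s := univ) (v := v) (f := p) hv.injOn (by simpa using hp)
  have h2 := Lagrange.eval_interpolate_not_at_node (s := univ) (v := v) (x := x)
    (fun i => p.eval (v i)) (fun i _ => hx i)
  rw [← h1, Lagrange.eval_nodal] at h2
  rw [h2, mul_div_cancel_left₀]
  · exact sum_congr rfl fun i _ => by rw [div_eq_mul_inv]; ring
  · rw [prod_ne_zero_iff]; exact fun i _ => sub_ne_zero.2 (hx i)

def bb {n : ℕ} (m : Fin n → ℝ) (σ ω₀ : ℝ) : Fin n ⊕ Bool → ℂ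
  | Sum.inl k => I * (m k : ℂ)
  | Sum.inr true => (ω₀ : ℂ) + I * σ
  | Sum.inr false => -(ω₀ : ℂ) + I * σ

/-- integral-free (partial-fraction) representation in λ of the
ω-integral of an n-soliton potential: there exist λ-independent constants
c_k, d_k, a₀, a₁, a₂, a₃ such that for admissible λ in the upper half plane,
∫ ω·p(ω²)/((ω² − λ²)((ω − ω₀)² + σ²)∏ₖ(ω² + m_k²)) dω
  = Σₖ (c_k + d_kλ)/(λ² + m_k²)
    + (a₀ + a₁λ + a₂λ² + a₃λ³)/((ω₀² − σ² − λ²)² + 4ω₀²σ²). -/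
theorem stmt8 (n : ℕ) (hn : 1 ≤ n) (m : Fin n → ℝ)
    (hm : ∀ k, 0 < m k) (hminj : Function.Injective m)
    (σ ω₀ : ℝ) (hσ : 0 < σ)
    (hdist : ∀ k, I * (m k : ℂ) ≠ (ω₀ : ℂ) + I * σ)
    (p : Polynomial ℂ) (hp : p.degree ≤ n) :
    ∃ c d : Fin n → ℂ, ∃ a₀ a₁ a₂ a₃ : ℂ,
      ∀ lam : ℂ, 0 < lam.im →
        (∀ k, lam ≠ I * (m k : ℂ)) →
        lam ≠ (ω₀ : ℂ) + I * σ → lam ≠ -(ω₀ : ℂ) + I * σ →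
        (∫ ω : ℝ, (ω : ℂ) * p.eval ((ω : ℂ) ^ 2) /
            (((ω : ℂ) ^ 2 - lam ^ 2) * (((ω : ℂ) - ω₀) ^ 2 + (σ : ℂ) ^ 2) *
              ∏ k, ((ω : ℂ) ^ 2 + (m k : ℂ) ^ 2)))
          = (∑ k, (c k + d k * lam) / (lam ^ 2 + (m k : ℂ) ^ 2))
            + (a₀ + a₁ * lam + a₂ * lam ^ 2 + a₃ * lam ^ 3) /
                (((ω₀ : ℂ) ^ 2 - (σ : ℂ) ^ 2 - lam ^ 2) ^ 2 +
                  4 * (ω₀ : ℂ) ^ 2 * (σ : ℂ) ^ 2) := by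
  rcases eq_or_ne ω₀ 0 with h0 | h0
  · subst h0
    refine ⟨fun _ => 0, fun _ => 0, 0, 0, 0, 0, fun lam hl _ _ _ => ?_⟩
    simp only [zero_mul, add_zero, zero_div, sum_const_zero]
    rw [← self_eq_neg, ← integral_neg, ← integral_neg_eq_self]
    congr 1
    funext w
    push_cast
    simp only [sub_zero, neg_sq, neg_mul, neg_div]
  have hbim : ∀ i, 0 < (bb m σ ω₀ i).im := by
    rintro (k | _ | _) <;> simp [bb, hm, hσ]
  have hinj : Function.Injective (bb m σ ω₀) := by
    have h0' : -ω₀ ≠ ω₀ := fun h => h0 (by linarith)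
    rintro (k | _ | _) (j | _ | _) h
    · have h2 := congrArg Complex.im h
      simp [bb] at h2
      rw [hminj h2]
    all_goals first
      | rfl
      | (exfalso
         have h2 := congrArg Complex.re h
         simp [bb] at h2
         first
           | exact h0 h2
           | exact h0 h2.symm
           | exact h0 (by linarith))
  have hsq : ∀ x y : ℂ, 0 < x.im → 0 < y.im → x^2 = y^2 → x = y := by
    intro x y hx hy h
    rcases sq_eq_sq_iff_eq_or_eq_neg.1 h with h | h
    · exact h
    · have := congrArg Complex.im h
      simp at this
      linarith
  obtain ⟨B, hB⟩ := pfrac (fun i => (bb m σ ω₀ i)^2)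
    (fun i j h => hinj (hsq _ _ (hbim i) (hbim j) h)) p (by
      refine hp.trans_lt ?_
      simp only [Fintype.card_sum, Fintype.card_fin, Fintype.card_bool]
      exact_mod_cast (by omega : n < n + 2))
  set z : ℂ := (ω₀ : ℂ) + I * σ with hz
  set y : ℂ := -(ω₀ : ℂ) + I * σ with hy
  have hD : ∀ x : ℂ, (x - z^2) * (x - y^2) =
      ((ω₀ : ℂ) ^ 2 - (σ : ℂ) ^ 2 - x) ^ 2 + 4 * (ω₀ : ℂ) ^ 2 * (σ : ℂ) ^ 2 := by
    intro x
    have hI : I^2 = -1 := Complex.I_sq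
    have e1 : z^2 = (ω₀:ℂ)^2 - σ^2 + 2 * I * ω₀ * σ := by
      rw [hz]; linear_combination (σ:ℂ)^2 * hI
    have e2 : y^2 = (ω₀:ℂ)^2 - σ^2 - 2 * I * ω₀ * σ := by
      rw [hy]; linear_combination (σ:ℂ)^2 * hI
    rw [e1, e2]
    linear_combination (-4 * (ω₀:ℂ)^2 * σ^2) * hI
  have hmm : ∀ k, (I * (m k : ℂ))^2 = - (m k : ℂ)^2 := by
    intro k; rw [mul_pow, Complex.I_sq]; ring
  have hP : ∀ x : ℂ, ∏ i, (x - (bb m σ ω₀ i)^2) =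
      (∏ k, (x + (m k : ℂ)^2)) * ((x - z^2) * (x - y^2)) := by
    intro x
    simp only [Fintype.prod_sum_type, Fintype.prod_bool, bb, hmm, sub_neg_eq_add, hz, hy]
  refine ⟨fun k => π * I * 2 * ω₀ * B (Sum.inl k) * (-(I * m k)), fun k => π * I * 2 * ω₀ * B (Sum.inl k),
    π * I * 2 * ω₀ * (B (Sum.inr true) * z * y^2 + B (Sum.inr false) * y * z^2),
    π * I * 2 * ω₀ * (-B (Sum.inr true) * y^2 - B (Sum.inr false) * z^2),
    π * I * 2 * ω₀ * (-B (Sum.inr true) * z - B (Sum.inr false) * y),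
    π * I * 2 * ω₀ * (B (Sum.inr true) + B (Sum.inr false)), fun lam hl h1 h2 h3 => ?_⟩
  have hlb : ∀ i, lam ≠ bb m σ ω₀ i := by
    rintro (k | _ | _)
    · exact h1 k
    · exact h3
    · exact h2
  have hint := intf n m hm σ ω₀ hσ p hp lam hl
  set f : ℝ → ℂ := fun ω => (ω : ℂ) * p.eval ((ω : ℂ) ^ 2) /
            (((ω : ℂ) ^ 2 - lam ^ 2) * (((ω : ℂ) - ω₀) ^ 2 + (σ : ℂ) ^ 2) *
              ∏ k, ((ω : ℂ) ^ 2 + (m k : ℂ) ^ 2)) with hf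
  have hsym : ∫ ω, f ω = ∫ ω, (f ω + f (-ω)) / 2 := by
    rw [integral_div, integral_add hint hint.comp_neg, integral_neg_eq_self]
    ring
  have heven : ∀ ω : ℝ, (f ω + f (-ω)) / 2 = ∑ i, (2 * ω₀ * B i) *
      ((ω:ℂ)^2 / (((ω:ℂ)^2 - (bb m σ ω₀ i)^2) * ((ω:ℂ)^2 - lam^2))) := by
    intro ω
    have hb := hB ((ω:ℂ)^2) (fun i => sub_ne_zero.1 (sub_ne _ (hbim i) ω))
    have hPn : ∏ i, ((ω:ℂ)^2 - (bb m σ ω₀ i)^2) ≠ 0 := by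
      rw [prod_ne_zero_iff]; exact fun i _ => sub_ne _ (hbim i) ω
    rw [hP] at hb hPn
    have hln := sub_ne lam hl ω
    have n1 := left_ne_zero_of_mul hPn
    have n2 := right_ne_zero_of_mul hPn
    have hfac : ((ω:ℂ)^2 - z^2) * ((ω:ℂ)^2 - y^2) =
        (((ω : ℂ) - ω₀) ^ 2 + (σ : ℂ) ^ 2) * (((ω : ℂ) + ω₀) ^ 2 + (σ : ℂ) ^ 2) := by
      rw [hD]; ring
    rw [hfac] at hb n2
    have n3 := left_ne_zero_of_mul n2
    have n4 := right_ne_zero_of_mul n2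
    have hr : ∑ i, (2 * ω₀ * B i) *
        ((ω:ℂ)^2 / (((ω:ℂ)^2 - (bb m σ ω₀ i)^2) * ((ω:ℂ)^2 - lam^2))) =
        (2 * ω₀ * (ω:ℂ)^2 / ((ω:ℂ)^2 - lam^2)) * ∑ i, B i / ((ω:ℂ)^2 - (bb m σ ω₀ i)^2) := by
      rw [mul_sum]
      refine sum_congr rfl fun i _ => ?_
      have := sub_ne _ (hbim i) ω
      field_simp
    rw [hr, ← hb]
    have hfn : f (-ω) = -(ω : ℂ) * p.eval ((ω : ℂ) ^ 2) /
            (((ω : ℂ) ^ 2 - lam ^ 2) * (((ω : ℂ) + ω₀) ^ 2 + (σ : ℂ) ^ 2) *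
              ∏ k, ((ω : ℂ) ^ 2 + (m k : ℂ) ^ 2)) := by
      simp only [hf]
      push_cast
      have : (-(ω:ℂ) - ω₀)^2 = ((ω:ℂ) + ω₀)^2 := by ring
      rw [this]
      simp only [neg_sq]
    rw [hfn]
    simp only [hf]
    generalize ∏ k, ((ω : ℂ) ^ 2 + (m k : ℂ) ^ 2) = P at *
    generalize p.eval ((ω : ℂ) ^ 2) = q at *
    generalize (ω:ℂ)^2 - lam^2 = l at *
    field_simp
    ring
  have hI : ∫ ω, f ω = ∑ i, (2 * ω₀ * B i) * (π * I / (bb m σ ω₀ i + lam)) := by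
    rw [hsym]
    simp_rw [heven]
    rw [integral_finsetSum]
    · refine sum_congr rfl fun i _ => ?_
      rw [integral_const_mul, (integ2 _ lam (hbim i) hl (hlb i)).2]
    · exact fun i _ => (integ2 _ lam (hbim i) hl (hlb i)).1.const_mul _
  rw [hI, Fintype.sum_sum_type, Fintype.sum_bool]
  have hne : ∀ i, lam^2 - (bb m σ ω₀ i)^2 ≠ 0 := fun i h =>
    hlb i (hsq _ _ hl (hbim i) (sub_eq_zero.1 h))
  have hne2 : ∀ i, bb m σ ω₀ i + lam ≠ 0 := fun i h => hne i (by linear_combination (lam - bb m σ ω₀ i) * h)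
  congr 1
  · refine sum_congr rfl fun k _ => ?_
    have a1 := hne (Sum.inl k)
    have a2 := hne2 (Sum.inl k)
    have e : lam^2 + (m k : ℂ)^2 = lam^2 - (I * m k)^2 := by rw [hmm]; ring
    rw [e]
    simp only [bb] at a1 a2 ⊢
    rw [mul_div_assoc', div_eq_div_iff a2 a1]
    ring
  · have a1 : lam^2 - z^2 ≠ 0 := hne (Sum.inr true)
    have a2 : z + lam ≠ 0 := hne2 (Sum.inr true)
    have a3 : lam^2 - y^2 ≠ 0 := hne (Sum.inr false)
    have a4 : y + lam ≠ 0 := hne2 (Sum.inr false)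
    rw [← hD]
    change 2 * ω₀ * B (Sum.inr true) * (π * I / (z + lam)) + 2 * ω₀ * B (Sum.inr false) * (π * I / (y + lam)) = _
    clear_value z y
    rw [mul_div_assoc', mul_div_assoc', div_add_div _ _ a2 a4, div_eq_div_iff (mul_ne_zero a2 a4) (mul_ne_zero a1 a3)]
    ring
end
end

section
/- Let S ⊂ ℂ be a finite nonempty set. The bilinear form B is nondegenerate on Q_S: if X ∈ Q_S satisfies B(X,Y) = 0 for every Y ∈ Q_S, then X = 0. -/
open Polynomial

noncomputable section

/-- The polynomial part of a rational function: f = polyPart f + (proper part). -/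
def polyPart (f : RatFunc ℂ) : Polynomial ℂ := f.num /ₘ f.denom

/-- coeff₀(f): the constant coefficient of the polynomial part of f. -/
def coeff0 (f : RatFunc ℂ) : ℂ := (polyPart f).coeff 0

/-- The bilinear form B(X,Y) = coeff₀(Tr(XY)) on 2×2 matrices over ℂ(λ). -/
def Bform (X Y : Matrix (Fin 2) (Fin 2) (RatFunc ℂ)) : ℂ :=
  coeff0 (Matrix.trace (X * Y))

/-- A rational function is proper if deg(num) < deg(denom). -/
def IsProper (f : RatFunc ℂ) : Prop := f.num.degree < f.denom.degree

/-- All poles of f (zeros of its reduced denominator) lie in S. -/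
def PolesIn (f : RatFunc ℂ) (S : Set ℂ) : Prop :=
  ∀ z : ℂ, f.denom.eval z = 0 → z ∈ S

/-- f is a polynomial (lies in the image of ℂ[λ]). -/
def IsPolyRF (f : RatFunc ℂ) : Prop :=
  ∃ p : Polynomial ℂ, f = algebraMap (Polynomial ℂ) (RatFunc ℂ) p

theorem coeff0_ne_zero_aux (f : RatFunc ℂ) (hf : f ≠ 0) (hd : f.intDegree = 0) :
    coeff0 f ≠ 0 := by
  have hm : f.denom.Monic := RatFunc.monic_denom f
  have hn : f.num ≠ 0 := RatFunc.num_ne_zero hf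
  have hdeg : f.num.natDegree = f.denom.natDegree := by
    unfold RatFunc.intDegree at hd
    omega
  have h0 : (f.num /ₘ f.denom).natDegree = 0 := by
    rw [Polynomial.natDegree_divByMonic _ hm, hdeg, Nat.sub_self]
  have h1 : f.num /ₘ f.denom ≠ 0 := by
    rw [Ne, Polynomial.divByMonic_eq_zero_iff hm,
      Polynomial.degree_eq_natDegree hn, Polynomial.degree_eq_natDegree hm.ne_zero, hdeg]
    exact lt_irrefl _
  intro h
  apply h1
  rw [Polynomial.eq_C_of_natDegree_eq_zero h0]
  unfold coeff0 polyPart at h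
  rw [h, Polynomial.C_0]

/-- the form B is nondegenerate on Q_S, the matrices whose entries
have all their poles in the finite nonempty set S. -/
theorem stmt12 (S : Set ℂ) (hfin : S.Finite) (hne : S.Nonempty)
    (X : Matrix (Fin 2) (Fin 2) (RatFunc ℂ))
    (hX : ∀ i j, PolesIn (X i j) S)
    (hB : ∀ Y : Matrix (Fin 2) (Fin 2) (RatFunc ℂ),
      (∀ i j, PolesIn (Y i j) S) → Bform X Y = 0) :
    X = 0 := by
  obtain ⟨s, hs⟩ := hne
  ext i j
  by_contra hf
  rw [Matrix.zero_apply] at hf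
  set f := X i j with hfdef
  have hp : ∀ n : ℕ, (Polynomial.X - C s : ℂ[X]) ^ n ≠ 0 :=
    fun n => pow_ne_zero _ (X_sub_C_ne_zero s)
  have ha : ∀ n : ℕ, algebraMap ℂ[X] (RatFunc ℂ) ((Polynomial.X - C s) ^ n) ≠ 0 :=
    fun n => RatFunc.algebraMap_ne_zero (hp n)
  set g : RatFunc ℂ := algebraMap ℂ[X] (RatFunc ℂ) ((Polynomial.X - C s) ^ f.denom.natDegree) /
    algebraMap ℂ[X] (RatFunc ℂ) ((Polynomial.X - C s) ^ f.num.natDegree) with hg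
  have hg0 : g ≠ 0 := div_ne_zero (ha _) (ha _)
  have hgp : PolesIn g S := by
    intro z hz
    have hdvd : g.denom ∣ (Polynomial.X - C s) ^ f.num.natDegree := RatFunc.denom_div_dvd _ _
    have h := Polynomial.eval_eq_zero_of_dvd_of_eval_eq_zero hdvd hz
    rw [eval_pow, eval_sub, eval_X, eval_C] at h
    have h2 := eq_zero_of_pow_eq_zero h
    rw [sub_eq_zero.mp h2]
    exact hs
  have h := hB (Matrix.single j i g) (by
    intro a b
    rw [Matrix.single_apply]
    split_ifs
    · exact hgp
    · intro z hz
      simp at hz)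
  have htr : Matrix.trace (X * Matrix.single j i g) = f * g := by
    rw [Matrix.trace_mul_single]
    simp [hfdef, mul_comm]
  unfold Bform at h
  rw [htr] at h
  refine coeff0_ne_zero_aux (f * g) (mul_ne_zero hf hg0) ?_ h
  rw [RatFunc.intDegree_mul hf hg0, hg, div_eq_mul_inv,
    RatFunc.intDegree_mul (ha _) (inv_ne_zero (ha _)), RatFunc.intDegree_inv,
    RatFunc.intDegree_polynomial, RatFunc.intDegree_polynomial, natDegree_pow, natDegree_pow,
    natDegree_X_sub_C]
  unfold RatFunc.intDegree
  push_cast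
  ring
end
end

section
/- Let X be a 2×2 matrix over ℂ(λ). Then B(X,Y) = 0 for every 2×2 matrix Y with polynomial entries if and only if every entry of X is a polynomial with zero constant coefficient (i.e. X ∈ λ·b). This identifies the orthogonal complement b^⊥ of the subalgebra b of matrix polynomials with respect to the form B as b^⊥ = { Σ_{j≥1} X_j λ^j }. -/
open Polynomial

noncomputable section

theorem polyPart_unique (f : RatFunc ℂ) (q r d : Polynomial ℂ) (hd : d.Monic)
    (hr : r.degree < d.degree)
    (h : f * algebraMap (Polynomial ℂ) (RatFunc ℂ) d =
      algebraMap (Polynomial ℂ) (RatFunc ℂ) (d * q + r)) : polyPart f = q := by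
  have hm : f.denom.Monic := RatFunc.monic_denom f
  have hf : f * algebraMap (Polynomial ℂ) (RatFunc ℂ) f.denom =
      algebraMap (Polynomial ℂ) (RatFunc ℂ) f.num := by
    have h0 : algebraMap (Polynomial ℂ) (RatFunc ℂ) f.denom ≠ 0 :=
      RatFunc.algebraMap_ne_zero hm.ne_zero
    have := RatFunc.num_div_denom f
    rw [div_eq_iff h0] at this
    exact this.symm
  have key : f.num * d = (d * q + r) * f.denom := by
    apply RatFunc.algebraMap_injective ℂ
    rw [map_mul, map_mul, ← hf, ← h]
    ring
  have hs : (f.num - f.denom * q) * d = r * f.denom := by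
    linear_combination key
  have hdeg : (f.num - f.denom * q).degree < f.denom.degree := by
    by_contra hcon
    push Not at hcon
    have e := congrArg Polynomial.degree hs
    rw [degree_mul, degree_mul] at e
    have hdd := degree_eq_natDegree hd.ne_zero
    have hmm := degree_eq_natDegree hm.ne_zero
    have hs0 : f.num - f.denom * q ≠ 0 := by
      intro h0
      rw [h0, hmm] at hcon
      simp at hcon
    have hr0 : r ≠ 0 := by
      rintro rfl
      rw [zero_mul] at hs
      exact (mul_ne_zero hs0 hd.ne_zero) hs
    rw [degree_eq_natDegree hs0] at e hcon
    rw [degree_eq_natDegree hr0] at e hr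
    rw [hdd] at e hr
    rw [hmm] at e hcon
    norm_cast at e hr hcon
    omega
  exact (div_modByMonic_unique q (f.num - f.denom * q) hm ⟨by ring, hdeg⟩).1

theorem polyPart_poly (p : Polynomial ℂ) :
    polyPart (algebraMap (Polynomial ℂ) (RatFunc ℂ) p) = p :=
  polyPart_unique _ p 0 1 monic_one (by simp) (by simp)

theorem scalar_case (f : RatFunc ℂ)
    (h : ∀ g : Polynomial ℂ, coeff0 (f * algebraMap (Polynomial ℂ) (RatFunc ℂ) g) = 0) :
    ∃ p : Polynomial ℂ, f = algebraMap (Polynomial ℂ) (RatFunc ℂ) p ∧ p.coeff 0 = 0 := by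
  have hm : f.denom.Monic := RatFunc.monic_denom f
  have h0 : algebraMap (Polynomial ℂ) (RatFunc ℂ) f.denom ≠ 0 :=
    RatFunc.algebraMap_ne_zero hm.ne_zero
  have hf : f * algebraMap (Polynomial ℂ) (RatFunc ℂ) f.denom =
      algebraMap (Polynomial ℂ) (RatFunc ℂ) f.num := by
    have := RatFunc.num_div_denom f
    rw [div_eq_iff h0] at this
    exact this.symm
  have hdm := modByMonic_add_div f.num f.denom
  have hlt := degree_modByMonic_lt f.num hm
  generalize f.num %ₘ f.denom = r at hdm hlt
  generalize f.num /ₘ f.denom = q at hdm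
  by_cases hr : r = 0
  · subst hr
    have hfq : f = algebraMap (Polynomial ℂ) (RatFunc ℂ) q := by
      apply mul_right_cancel₀ h0
      rw [hf, ← map_mul, ← hdm]
      congr 1
      ring
    refine ⟨q, hfq, ?_⟩
    have := h 1
    rw [map_one, mul_one, hfq, coeff0, polyPart_poly] at this
    exact this
  · exfalso
    have hnat : r.natDegree < f.denom.natDegree := natDegree_lt_natDegree hr hlt
    obtain ⟨k, hk⟩ := Nat.exists_eq_add_of_lt hnat
    have hlc : r.leadingCoeff ≠ 0 := leadingCoeff_ne_zero.mpr hr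
    have hs : (r * X ^ (k + 1) - f.denom * C r.leadingCoeff).degree < f.denom.degree := by
      have e1 : (r * X ^ (k + 1)).degree = f.denom.degree := by
        rw [degree_mul, degree_X_pow, degree_eq_natDegree hr, degree_eq_natDegree hm.ne_zero, hk]
        norm_cast
      have e2 : (f.denom * C r.leadingCoeff).degree = f.denom.degree := by
        rw [degree_mul, degree_C hlc, add_zero]
      have := degree_sub_lt (e1.trans e2.symm) (mul_ne_zero hr (pow_ne_zero _ X_ne_zero))
        (by simp [hm.leadingCoeff])
      rwa [e1] at this
    have hp := polyPart_unique (f * algebraMap (Polynomial ℂ) (RatFunc ℂ) (X ^ (k + 1)))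
      (q * X ^ (k + 1) + C r.leadingCoeff) _ f.denom hm hs (by
        rw [mul_right_comm, hf, ← map_mul, ← hdm]
        congr 1
        ring)
    have := h (X ^ (k + 1))
    rw [coeff0, hp] at this
    simp [pow_succ, ← mul_assoc] at this
    exact hr this

/-- B(X,Y) = 0 for every matrix Y with polynomial entries iff every
entry of X is a polynomial with zero constant coefficient, i.e. b^⊥ = λ·b. -/
theorem stmt13 (X : Matrix (Fin 2) (Fin 2) (RatFunc ℂ)) :
    (∀ Y : Matrix (Fin 2) (Fin 2) (RatFunc ℂ),
      (∀ i j, IsPolyRF (Y i j)) → Bform X Y = 0) ↔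
    (∀ i j, ∃ p : Polynomial ℂ,
      X i j = algebraMap (Polynomial ℂ) (RatFunc ℂ) p ∧ p.coeff 0 = 0) := by
  constructor
  · intro h i j
    apply scalar_case
    intro g
    have := h (Matrix.single j i (algebraMap (Polynomial ℂ) (RatFunc ℂ) g)) (by
      intro a b
      by_cases hab : j = a ∧ i = b
      · exact ⟨g, by simp [Matrix.single, hab]⟩
      · exact ⟨0, by simp [Matrix.single, hab]⟩)
    rw [Bform, Matrix.trace_mul_single] at this
    simpa [mul_comm] using this
  · intro h Y hY
    choose p hp hp0 using h
    choose y hy using hY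
    have e : Matrix.trace (X * Y) = algebraMap (Polynomial ℂ) (RatFunc ℂ)
        (∑ i, ∑ j, p i j * y j i) := by
      simp [Matrix.trace, Matrix.mul_apply, hp, hy]
    rw [Bform, e, coeff0, polyPart_poly]
    simp [mul_coeff_zero, hp0]
end
end

section
/- Let S ⊂ ℂ be a finite nonempty set and let X be a 2×2 matrix over ℂ(λ). Then B(X,Y) = 0 for every Y ∈ a_S if and only if the polynomial part of every entry of X is a constant (i.e. writing each entry as polynomial plus proper part, the polynomial has degree ≤ 0). This identifies the orthogonal complement a_S^⊥ with respect to B as the set of elements of the form X₀ + (proper part), X₀ a constant matrix. -/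
open Polynomial

noncomputable section

theorem isProper_iff (f : RatFunc ℂ) : IsProper f ↔ (f = 0 ∨ f.intDegree < 0) := by
  unfold IsProper RatFunc.intDegree
  by_cases h : f = 0
  · subst h
    simp
  · have h1 : f.num ≠ 0 := RatFunc.num_ne_zero h
    rw [Polynomial.degree_eq_natDegree h1, Polynomial.degree_eq_natDegree f.denom_ne_zero]
    simp only [h, false_or, Nat.cast_lt]
    omega

theorem isProper_add {f g : RatFunc ℂ} (hf : IsProper f) (hg : IsProper g) :
    IsProper (f + g) := by
  rw [isProper_iff] at *
  by_cases h : f + g = 0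
  · exact Or.inl h
  by_cases hf0 : f = 0
  · subst hf0
    simpa using hg
  by_cases hg0 : g = 0
  · subst hg0
    simpa using hf
  right
  have := RatFunc.intDegree_add_le hg0 h
  rcases hf with hf | hf
  · exact absurd hf hf0
  rcases hg with hg | hg
  · exact absurd hg hg0
  exact lt_of_le_of_lt this (max_lt hf hg)

theorem isProper_mul {f g : RatFunc ℂ} (hf : f.intDegree ≤ 0) (hg : IsProper g) :
    IsProper (f * g) := by
  rw [isProper_iff] at *
  by_cases hf0 : f = 0
  · simp [hf0]
  rcases hg with hg | hg
  · simp [hg]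
  by_cases hg0 : g = 0
  · simp [hg0]
  right
  rw [RatFunc.intDegree_mul hf0 hg0]
  omega

theorem polyPart_eq_zero_iff (f : RatFunc ℂ) : polyPart f = 0 ↔ IsProper f :=
  Polynomial.divByMonic_eq_zero_iff f.monic_denom

theorem polyPart_natDegree (f : RatFunc ℂ) :
    (polyPart f).natDegree = f.num.natDegree - f.denom.natDegree :=
  Polynomial.natDegree_divByMonic _ f.monic_denom

theorem polyPart_degree_le_iff (f : RatFunc ℂ) :
    (polyPart f).degree ≤ 0 ↔ f.intDegree ≤ 0 := by
  rw [← Polynomial.natDegree_eq_zero_iff_degree_le_zero, polyPart_natDegree, RatFunc.intDegree]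
  omega

theorem coeff0_ne_zero {f : RatFunc ℂ} (h0 : f ≠ 0) (h : f.intDegree = 0) : coeff0 f ≠ 0 := by
  intro hc
  have h1 := (polyPart_degree_le_iff f).2 h.le
  have h2 : polyPart f = 0 := by
    rw [Polynomial.eq_C_of_degree_le_zero h1]
    unfold coeff0 at hc
    simp [hc]
  rw [polyPart_eq_zero_iff, isProper_iff] at h2
  rcases h2 with h2 | h2
  · exact h0 h2
  · omega

/-- B(X,Y) = 0 for every Y ∈ a_S (entries proper with poles in the
finite nonempty set S) iff the polynomial part of every entry of X is a constant,
i.e. a_S^⊥ = {X₀ + (proper part) : X₀ constant}. -/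
theorem stmt14 (S : Set ℂ) (hfin : S.Finite) (hne : S.Nonempty)
    (X : Matrix (Fin 2) (Fin 2) (RatFunc ℂ)) :
    (∀ Y : Matrix (Fin 2) (Fin 2) (RatFunc ℂ),
      (∀ i j, IsProper (Y i j) ∧ PolesIn (Y i j) S) → Bform X Y = 0) ↔
    (∀ i j, (polyPart (X i j)).degree ≤ 0) := by
  constructor
  · intro H i j
    by_contra hd
    rw [polyPart_degree_le_iff] at hd
    obtain ⟨s, hs⟩ := hne
    have hx0 : X i j ≠ 0 := by
      intro h
      simp [h] at hd
    obtain ⟨n, hn⟩ : ∃ n : ℕ, (X i j).intDegree = n := ⟨(X i j).intDegree.toNat, by omega⟩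
    set p : Polynomial ℂ := (Polynomial.X - Polynomial.C s) ^ n with hp
    have hp0 : p ≠ 0 := pow_ne_zero _ (Polynomial.X_sub_C_ne_zero s)
    have hpd : p.natDegree = n := by simp [hp]
    set g : RatFunc ℂ := algebraMap _ _ (1 : Polynomial ℂ) / algebraMap _ _ p with hg
    have hpa : algebraMap (Polynomial ℂ) (RatFunc ℂ) p ≠ 0 := RatFunc.algebraMap_ne_zero hp0
    have hg0 : g ≠ 0 := by
      rw [hg, map_one]
      exact div_ne_zero one_ne_zero hpa
    have hgd : g.intDegree = -n := by
      rw [hg, map_one, one_div, RatFunc.intDegree_inv, RatFunc.intDegree_polynomial, hpd]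
    have hgp : IsProper g := by
      rw [isProper_iff]
      right
      omega
    have hgs : PolesIn g S := by
      intro z hz
      have h1 := Polynomial.eval_dvd (x := z) (RatFunc.denom_div_dvd (1 : Polynomial ℂ) p)
      rw [← hg, hz, zero_dvd_iff, hp] at h1
      simp only [Polynomial.eval_pow, Polynomial.eval_sub, Polynomial.eval_X,
        Polynomial.eval_C] at h1
      have h2 := sub_eq_zero.1 (eq_zero_of_pow_eq_zero h1)
      rwa [h2]
    have hB := H (Matrix.single j i g) (by
      intro a b
      rw [Matrix.single_apply]
      split_ifs
      · exact ⟨hgp, hgs⟩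
      · refine ⟨(isProper_iff _).2 (Or.inl rfl), ?_⟩
        intro z hz
        simp at hz)
    have ht : Matrix.trace (X * Matrix.single j i g) = X i j * g := by
      rw [Matrix.trace_mul_single]
      simp
    rw [Bform, ht] at hB
    refine coeff0_ne_zero (mul_ne_zero hx0 hg0) ?_ hB
    rw [RatFunc.intDegree_mul hx0 hg0]
    omega
  · intro H Y hY
    have hm : ∀ i j, IsProper (X i j * Y j i) := fun i j =>
      isProper_mul ((polyPart_degree_le_iff _).1 (H i j)) (hY j i).1
    have ht : IsProper (Matrix.trace (X * Y)) := by
      simp only [Matrix.trace, Matrix.diag, Matrix.mul_apply, Fin.sum_univ_two]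
      exact isProper_add (isProper_add (hm _ _) (hm _ _)) (isProper_add (hm _ _) (hm _ _))
    rw [Bform, coeff0, (polyPart_eq_zero_iff _).2 ht, Polynomial.coeff_zero]
end
end
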